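/- Let r ∈ L²_loc(ℝ; ℝ), let q = B(r) = r' + r² (encoded by the antiderivative Q(x) = r(x) + ∫₀ˣ r(s)² ds), and suppose λ₀(q) > 0, i.e. there is ε > 0 with ∫ (φ'(x) − r(x)φ(x))² dx ≥ ε ∫ φ(x)² dx for every φ ∈ C_c^∞(ℝ; ℝ). Suppose y is a solution of L_q y = 0 on ℝ (in the system sense) such that either (i) y ∈ L²(0, ∞) and y' − r·y ∈ L²(0, ∞), or (ii) y ∈ L²(−∞, 0) and y' − r·y ∈ L²(−∞, 0). Then either y has no zeros on ℝ, or y is identically zero on ℝ. -/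

import Mathlib

open MeasureTheory Filter Set intervalIntegral ENNReal

/-- `Q : ℝ → ℝ` is (real-valued and) locally square integrable on `ℝ`. -/
def LocL2 (Q : ℝ → ℝ) : Prop :=
  Measurable Q ∧ ∀ a b : ℝ, IntegrableOn (fun x => Q x ^ 2) (Set.Icc a b) volume

/-- `y` together with the companion function `u` (representing `u = y' - Q·y`) solves the
first-order system `y' = Q y + u`, `u' = -Q² y - Q u` equivalent to `L_q y = 0` with `q = Q'`,
expressed through integral equations (encoding local absolute continuity). -/
def SolvesWith (Q y u : ℝ → ℝ) : Prop :=
  (∀ x : ℝ, y x = y 0 + ∫ t in (0:ℝ)..x, (Q t * y t + u t)) ∧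
  (∀ x : ℝ, u x = u 0 + ∫ t in (0:ℝ)..x, (-(Q t) ^ 2 * y t - Q t * u t))

/-- `y` solves `L_q y = 0` on `ℝ` in the system sense, `q = Q'`. -/
def Solves (Q y : ℝ → ℝ) : Prop := ∃ u : ℝ → ℝ, SolvesWith Q y u

/-- `L_q ≥ 0` for `q = Q'`: for every real-valued test function `φ`,
`∫ φ'² dx - 2 ∫ Q φ φ' dx ≥ 0` (the second term is the pairing `(q, φ²)`). -/
def LqNonneg (Q : ℝ → ℝ) : Prop :=
  ∀ φ : ℝ → ℝ, ContDiff ℝ (⊤ : ℕ∞) φ → HasCompactSupport φ →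
    0 ≤ (∫ x : ℝ, deriv φ x ^ 2) - 2 * ∫ x : ℝ, Q x * φ x * deriv φ x

/-- The Riccati relation `q = B(r) = r' + r²` for `q = Q'`: there is a constant `C` with
`r x + ∫₀ˣ r² = Q x + C` for almost every `x`. -/
def Riccati (Q r : ℝ → ℝ) : Prop :=
  ∃ C : ℝ, ∀ᵐ x : ℝ ∂volume, r x + (∫ s in (0:ℝ)..x, r s ^ 2) = Q x + C

/-- If `f` is Lipschitz on the image of an absolutely continuous function `g`, then `f ∘ g` is
absolutely continuous. -/
theorem LipschitzOnWith.comp_absolutelyContinuousOnInterval {f g : ℝ → ℝ} {a b : ℝ} {K : NNReal}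
    (hf : LipschitzOnWith K f (g '' uIcc a b)) (hg : AbsolutelyContinuousOnInterval g a b) :
    AbsolutelyContinuousOnInterval (fun x => f (g x)) a b := by
  unfold AbsolutelyContinuousOnInterval at hg ⊢
  refine squeeze_zero' (Eventually.of_forall fun E => Finset.sum_nonneg fun i _ => dist_nonneg) ?_
    (by simpa using hg.const_mul (K : ℝ))
  have h := mem_inf_of_right (f := AbsolutelyContinuousOnInterval.totalLengthFilter)
    (mem_principal_self (AbsolutelyContinuousOnInterval.disjWithin a b))
  filter_upwards [h] with E hE
  rw [Finset.mul_sum]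
  exact Finset.sum_le_sum fun i hi => hf.dist_le_mul _ (mem_image_of_mem g (hE.1 i hi).1) _
    (mem_image_of_mem g (hE.1 i hi).2)

/-- The exponential of an absolutely continuous function is absolutely continuous. -/
theorem AbsolutelyContinuousOnInterval.rexp {g : ℝ → ℝ} {a b : ℝ}
    (hg : AbsolutelyContinuousOnInterval g a b) :
    AbsolutelyContinuousOnInterval (fun x => Real.exp (g x)) a b := by
  have hc : IsCompact (g '' uIcc a b) := isCompact_uIcc.image_of_continuousOn hg.continuousOn
  obtain ⟨M, hM⟩ := hc.bddAbove
  refine LipschitzOnWith.comp_absolutelyContinuousOnInterval (K := (Real.exp M).toNNReal)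
    (LipschitzOnWith.mono ?_ (fun z hz => hM hz : g '' uIcc a b ⊆ Iic M)) hg
  refine (convex_Iic M).lipschitzOnWith_of_nnnorm_deriv_le
    (fun _ _ => Real.differentiable_exp.differentiableAt) fun z hz => ?_
  rw [Real.deriv_exp, Real.le_toNNReal_iff_coe_le (Real.exp_pos M).le, coe_nnnorm,
    Real.norm_of_nonneg (Real.exp_pos z).le]
  exact Real.exp_le_exp.2 hz

/-- A function with an integral representation is absolutely continuous and has the integrand as
its derivative almost everywhere. -/
theorem absolutelyContinuous_and_ae_hasDerivAt_of_eq_integral {F f : ℝ → ℝ} {c b : ℝ}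
    (hF : ∀ x, F x = c + ∫ t in (0:ℝ)..x, f t) (hf : IntervalIntegrable f volume 0 b) :
    AbsolutelyContinuousOnInterval F 0 b ∧ ∀ᵐ x, x ∈ uIcc 0 b → HasDerivAt F (f x) x := by
  have hF' : F = fun x => c + ∫ t in (0:ℝ)..x, f t := funext hF
  rw [hF']
  constructor
  · exact (contDiff_const.contDiffOn.absolutelyContinuousOnInterval).fun_add
      (hf.absolutelyContinuousOnInterval_intervalIntegral left_mem_uIcc)
  · filter_upwards [hf.ae_hasDerivAt_integral] with x hx hxb
    exact (hx hxb 0 left_mem_uIcc).const_add c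

theorem AbsolutelyContinuousOnInterval.eq_of_ae_hasDerivAt_zero {F : ℝ → ℝ} {a b : ℝ}
    (hF : AbsolutelyContinuousOnInterval F a b)
    (hd : ∀ᵐ x, x ∈ uIcc a b → HasDerivAt F 0 x) : F b = F a := by
  obtain ⟨C, hC⟩ := hF.const_of_ae_hasDerivAt_zero hd
  rw [hC b right_mem_uIcc, hC a left_mem_uIcc]

namespace LocL2

variable {r : ℝ → ℝ}

theorem intervalIntegrable_sq (hr : LocL2 r) (a b : ℝ) :
    IntervalIntegrable (fun x => r x ^ 2) volume a b :=
  ((hr.2 (min a b) (max a b))).intervalIntegrable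

theorem intervalIntegrable (hr : LocL2 r) (a b : ℝ) : IntervalIntegrable r volume a b := by
  refine ((hr.intervalIntegrable_sq a b).add
    (intervalIntegrable_const (c := (1:ℝ)))).mono_fun hr.1.aestronglyMeasurable ?_
  refine Eventually.of_forall fun x => ?_
  simp only [Real.norm_eq_abs]
  rw [abs_of_nonneg (by positivity : 0 ≤ r x ^ 2 + 1), ← sq_abs]
  nlinarith [sq_nonneg (|r x| - 1), abs_nonneg (r x)]

theorem continuous_integral_sq (hr : LocL2 r) : Continuous fun x => ∫ s in (0:ℝ)..x, r s ^ 2 :=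
  continuous_primitive hr.intervalIntegrable_sq 0

/-- Adding a continuous function preserves local square integrability. -/
theorem of_eq_add_continuous (hr : LocL2 r) {Q R : ℝ → ℝ} (hR : Continuous R)
    (hQ : ∀ x, Q x = r x + R x) : LocL2 Q := by
  obtain rfl : Q = fun x => r x + R x := funext hQ
  refine ⟨hr.1.add hR.measurable, fun a b => ?_⟩
  have h : IntegrableOn (fun x => 2 * r x ^ 2 + 2 * R x ^ 2) (Icc a b) :=
    ((hr.2 a b).const_mul 2).add ((by fun_prop : Continuous fun x => 2 * R x ^ 2).integrableOn_Icc)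
  refine h.mono' ((hr.1.add hR.measurable).pow_const 2).aestronglyMeasurable
    (Eventually.of_forall fun x => ?_)
  rw [Real.norm_of_nonneg (sq_nonneg _)]
  nlinarith [sq_nonneg (r x - R x)]

end LocL2

/-- Explicit solution of the first-order system, on any interval where both right-hand sides are
integrable: the quasi-derivative `P y = y' - r y = R y + u` satisfies `(P y)' = - r P y`, and
`y' = r y + P y`. -/
theorem SolvesWith.eq_explicit {r Q y u : ℝ → ℝ} (hr : LocL2 r)
    (hQ : ∀ x : ℝ, Q x = r x + ∫ s in (0:ℝ)..x, r s ^ 2) (hy : SolvesWith Q y u) {b : ℝ}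
    (hf : IntervalIntegrable (fun t => Q t * y t + u t) volume 0 b)
    (hg : IntervalIntegrable (fun t => -(Q t) ^ 2 * y t - Q t * u t) volume 0 b) :
    (∫ s in (0:ℝ)..b, r s ^ 2) * y b + u b = u 0 * Real.exp (-∫ s in (0:ℝ)..b, r s) ∧
    y b = Real.exp (∫ s in (0:ℝ)..b, r s) *
      (y 0 + u 0 * ∫ t in (0:ℝ)..b, Real.exp (-(∫ s in (0:ℝ)..t, r s)) ^ 2) := by
  obtain ⟨yA, yD⟩ := absolutelyContinuous_and_ae_hasDerivAt_of_eq_integral hy.1 hf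
  obtain ⟨uA, uD⟩ := absolutelyContinuous_and_ae_hasDerivAt_of_eq_integral hy.2 hg
  obtain ⟨RA, RD⟩ := absolutelyContinuous_and_ae_hasDerivAt_of_eq_integral
    (F := fun x => ∫ s in (0:ℝ)..x, r s ^ 2) (c := 0) (fun x => (zero_add _).symm)
    (hr.intervalIntegrable_sq 0 b)
  obtain ⟨pA, pD⟩ := absolutelyContinuous_and_ae_hasDerivAt_of_eq_integral
    (F := fun x => ∫ s in (0:ℝ)..x, r s) (c := 0) (fun x => (zero_add _).symm)
    (hr.intervalIntegrable 0 b)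
  set R : ℝ → ℝ := fun x => ∫ s in (0:ℝ)..x, r s ^ 2 with hRdef
  set p : ℝ → ℝ := fun x => ∫ s in (0:ℝ)..x, r s with hpdef
  have hR0 : R 0 = 0 := integral_same
  have hp0 : p 0 = 0 := integral_same
  have key : ∀ x ∈ uIcc 0 b, (R x * y x + u x) * Real.exp (p x) = u 0 := by
    intro x hx
    have hsub : uIcc 0 x ⊆ uIcc 0 b := uIcc_subset_uIcc_left hx
    have h := AbsolutelyContinuousOnInterval.eq_of_ae_hasDerivAt_zero
      ((((RA.fun_mul yA).fun_add uA).fun_mul pA.rexp).mono hsub) ?_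
    · simpa [hR0, hp0] using h
    · filter_upwards [yD, uD, RD, pD] with t h1 h2 h3 h4 ht
      have ht := hsub ht
      convert! (((h3 ht).mul (h1 ht)).add (h2 ht)).mul (h4 ht).exp using 1
      simp only [Pi.mul_apply, Pi.add_apply]
      rw [show Q t = r t + R t from hQ t]
      ring
  have key' : ∀ x ∈ uIcc 0 b, R x * y x + u x = u 0 * Real.exp (-p x) := by
    intro x hx
    rw [← key x hx, mul_assoc, ← Real.exp_add, add_neg_cancel, Real.exp_zero, mul_one]
  refine ⟨key' b right_mem_uIcc, ?_⟩
  have hpc : Continuous p := continuous_primitive hr.intervalIntegrable 0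
  have hec : Continuous fun t => Real.exp (-p t) ^ 2 := by fun_prop
  obtain ⟨IA, ID⟩ := absolutelyContinuous_and_ae_hasDerivAt_of_eq_integral
    (F := fun x => ∫ t in (0:ℝ)..x, Real.exp (-p t) ^ 2) (c := 0) (fun x => (zero_add _).symm)
    (hec.intervalIntegrable 0 b)
  have h := AbsolutelyContinuousOnInterval.eq_of_ae_hasDerivAt_zero
    ((yA.fun_mul pA.fun_neg.rexp).fun_sub (IA.const_mul (u 0))) ?_
  · simp only [hp0, neg_zero, Real.exp_zero, mul_one, integral_same, mul_zero, sub_zero] at h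
    rw [← h]
    change y b = Real.exp (p b) * _
    rw [sub_add_cancel, mul_comm (y b), ← mul_assoc, ← Real.exp_add, add_neg_cancel, Real.exp_zero,
      one_mul]
  · filter_upwards [yD, pD, ID] with t h1 h3 h4 ht
    convert! ((h1 ht).mul (h3 ht).neg.exp).sub ((h4 ht).const_mul (u 0)) using 1
    have h5 := key' t ht
    have h6 : u t = u 0 * Real.exp (-p t) - R t * y t := by linarith
    simp only [Pi.neg_apply]
    rw [show Q t = r t + R t from hQ t, h6]
    ring

/-- If the solution agrees with continuous functions wherever both right-hand sides are integrable,
then both right-hand sides are integrable on every interval `[0, x]`. -/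
theorem SolvesWith.intervalIntegrable_of_nonneg {Q y u Y U : ℝ → ℝ} (hQ : LocL2 Q)
    (hy : SolvesWith Q y u) (hY : Continuous Y) (hU : Continuous U)
    (hYU : ∀ t, IntervalIntegrable (fun t => Q t * y t + u t) volume 0 t →
      IntervalIntegrable (fun t => -(Q t) ^ 2 * y t - Q t * u t) volume 0 t →
      y t = Y t ∧ u t = U t) {x : ℝ} (hx : 0 ≤ x) :
    IntervalIntegrable (fun t => Q t * y t + u t) volume 0 x ∧
      IntervalIntegrable (fun t => -(Q t) ^ 2 * y t - Q t * u t) volume 0 x := by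
  set f : ℝ → ℝ := fun t => Q t * y t + u t with hf
  set g : ℝ → ℝ := fun t => -(Q t) ^ 2 * y t - Q t * u t with hg
  have intF : ∀ {a b : ℝ} {z w : ℝ → ℝ}, a ≤ b → ContinuousOn z (Icc a b) →
      ContinuousOn w (Icc a b) → (∀ t ∈ Ioo a b, y t = z t ∧ u t = w t) →
      IntervalIntegrable f volume a b := by
    intro a b z w hab hz hw h
    rw [← uIcc_of_le hab] at hz hw
    refine IntervalIntegrable.congr_uIoo (f := fun t => Q t * z t + w t)
      (((hQ.intervalIntegrable a b).mul_continuousOn hz).add hw.intervalIntegrable) ?_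
    intro t ht
    rw [uIoo_of_le hab] at ht
    simp only [hf, h t ht]
  have intG : ∀ {a b : ℝ} {z w : ℝ → ℝ}, a ≤ b → ContinuousOn z (Icc a b) →
      ContinuousOn w (Icc a b) → (∀ t ∈ Ioo a b, y t = z t ∧ u t = w t) →
      IntervalIntegrable g volume a b := by
    intro a b z w hab hz hw h
    rw [← uIcc_of_le hab] at hz hw
    refine IntervalIntegrable.congr_uIoo (f := fun t => -(Q t) ^ 2 * z t - Q t * w t)
      (((IntervalIntegrable.neg (hQ.intervalIntegrable_sq a b)).mul_continuousOn hz).sub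
        ((hQ.intervalIntegrable a b).mul_continuousOn hw)) ?_
    intro t ht
    rw [uIoo_of_le hab] at ht
    simp only [hg, h t ht]
  have down : ∀ {h : ℝ → ℝ} {s t : ℝ}, 0 ≤ s → s ≤ t → IntervalIntegrable h volume 0 t →
      IntervalIntegrable h volume 0 s := fun hs hst h =>
    h.mono_set (by rw [uIcc_of_le hs, uIcc_of_le (hs.trans hst)]; exact Icc_subset_Icc_right hst)
  by_contra hcon
  set S : Set ℝ := {t | t ∈ Icc 0 x ∧ IntervalIntegrable f volume 0 t ∧
    IntervalIntegrable g volume 0 t} with hS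
  have hS0 : (0:ℝ) ∈ S := ⟨⟨le_rfl, hx⟩, by simp, by simp⟩
  have hSb : BddAbove S := ⟨x, fun t ht => ht.1.2⟩
  set m := sSup S with hm
  have hm0 : 0 ≤ m := le_csSup hSb hS0
  have hmx : m ≤ x := csSup_le ⟨0, hS0⟩ fun t ht => ht.1.2
  have below : ∀ t ∈ Ioo 0 m, y t = Y t ∧ u t = U t := by
    intro t ht
    obtain ⟨s, hs, hts⟩ := exists_lt_of_lt_csSup ⟨0, hS0⟩ ht.2
    exact hYU t (down ht.1.le hts.le hs.2.1) (down ht.1.le hts.le hs.2.2)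
  have fm := intF hm0 hY.continuousOn hU.continuousOn below
  have gm := intG hm0 hY.continuousOn hU.continuousOn below
  have above : ∀ t ∈ Ioc m x, ¬ (IntervalIntegrable f volume 0 t ∧
      IntervalIntegrable g volume 0 t) := fun t ht h =>
    (le_csSup hSb (⟨⟨hm0.trans ht.1.le, ht.2⟩, h⟩ : t ∈ S)).not_gt ht.1
  have yconst : ∀ t, ¬ IntervalIntegrable f volume 0 t → y t = y 0 := fun t ht => by
    rw [hy.1 t, intervalIntegral.integral_undef ht, add_zero]
  have uconst : ∀ t, ¬ IntervalIntegrable g volume 0 t → u t = u 0 := fun t ht => by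
    rw [hy.2 t, intervalIntegral.integral_undef ht, add_zero]
  have nf : ∀ t ∈ Ioc m x, ¬ IntervalIntegrable f volume 0 t := by
    intro t ht hft
    have hyc := (absolutelyContinuous_and_ae_hasDerivAt_of_eq_integral hy.1 hft).1.continuousOn
    rw [uIcc_of_le (hm0.trans ht.1.le)] at hyc
    refine above t ht ⟨hft, gm.trans (intG ht.1.le (hyc.mono (Icc_subset_Icc_left hm0))
      (continuousOn_const (c := u 0)) fun s hs => ⟨rfl, uconst s fun hgs => ?_⟩)⟩
    exact above s ⟨hs.1, hs.2.le.trans ht.2⟩ ⟨down (hm0.trans hs.1.le) hs.2.le hft, hgs⟩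
  have ng : ∀ t ∈ Ioc m x, ¬ IntervalIntegrable g volume 0 t := by
    intro t ht hgt
    have huc := (absolutelyContinuous_and_ae_hasDerivAt_of_eq_integral hy.2 hgt).1.continuousOn
    rw [uIcc_of_le (hm0.trans ht.1.le)] at huc
    exact above t ht ⟨fm.trans (intF ht.1.le (continuousOn_const (c := y 0))
      (huc.mono (Icc_subset_Icc_left hm0)) fun s hs =>
        ⟨yconst s (nf s ⟨hs.1, hs.2.le.trans ht.2⟩), rfl⟩), hgt⟩
  have const : ∀ t ∈ Ioo m x, y t = y 0 ∧ u t = u 0 := fun t ht =>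
    ⟨yconst t (nf t (Ioo_subset_Ioc_self ht)), uconst t (ng t (Ioo_subset_Ioc_self ht))⟩
  exact hcon ⟨fm.trans (intF hmx continuousOn_const continuousOn_const const),
    gm.trans (intG hmx continuousOn_const continuousOn_const const)⟩

theorem LocL2.neg_comp_neg {r : ℝ → ℝ} (hr : LocL2 r) : LocL2 fun x => -r (-x) := by
  refine ⟨(hr.1.comp measurable_neg).neg, fun a b => ?_⟩
  rcases le_total a b with hab | hab
  · have h := (IntervalIntegrable.iff_comp_neg (by finiteness)).1
      (hr.intervalIntegrable_sq (-a) (-b))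
    rw [intervalIntegrable_iff_integrableOn_Icc_of_le] at h
    · simpa using h
    · simpa using hab
  · exact IntegrableOn.mono_set (by simp) (Icc_subset_Icc_left hab)

/-- Reflection `x ↦ -x` maps solutions to solutions. -/
theorem SolvesWith.reflect {Q y u : ℝ → ℝ} (hy : SolvesWith Q y u) :
    SolvesWith (fun x => -Q (-x)) (fun x => y (-x)) (fun x => -u (-x)) := by
  constructor
  · intro x
    have h := integral_comp_neg (a := 0) (b := x) fun t => Q t * y t + u t
    beta_reduce
    rw [hy.1 (-x), neg_zero, integral_symm, ← neg_zero, ← h, ← intervalIntegral.integral_neg,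
      neg_zero]
    congr 2 with t
    ring
  · intro x
    have h := integral_comp_neg (a := 0) (b := x) fun t => -(Q t) ^ 2 * y t - Q t * u t
    beta_reduce
    rw [hy.2 (-x), neg_zero, integral_symm, ← neg_zero, ← h, neg_add, neg_neg, neg_zero]
    congr 2 with t
    ring

/-- Reflection `x ↦ -x` turns the pair `(r, Q)` into `(-r(-·), -Q(-·))`. -/
theorem reflect_riccati {r Q : ℝ → ℝ} (hQ : ∀ x : ℝ, Q x = r x + ∫ s in (0:ℝ)..x, r s ^ 2)
    (x : ℝ) : -Q (-x) = -r (-x) + ∫ s in (0:ℝ)..x, (-r (-s)) ^ 2 := by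
  simp only [neg_sq]
  rw [integral_comp_neg fun s => r s ^ 2, hQ, neg_zero, integral_symm 0 (-x)]
  ring

/-- For `q = r' + r²` both right-hand sides of the first-order system are automatically
integrable. -/
theorem SolvesWith.intervalIntegrable_of_riccati {r Q y u : ℝ → ℝ} (hr : LocL2 r)
    (hQ : ∀ x : ℝ, Q x = r x + ∫ s in (0:ℝ)..x, r s ^ 2) (hy : SolvesWith Q y u) {x : ℝ}
    (hx : 0 ≤ x) :
    IntervalIntegrable (fun t => Q t * y t + u t) volume 0 x ∧
      IntervalIntegrable (fun t => -(Q t) ^ 2 * y t - Q t * u t) volume 0 x := by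
  have hpc : Continuous fun x => ∫ s in (0:ℝ)..x, r s :=
    continuous_primitive hr.intervalIntegrable 0
  have hRc := hr.continuous_integral_sq
  have hec : Continuous fun t => Real.exp (-(∫ s in (0:ℝ)..t, r s)) ^ 2 := by fun_prop
  have hIc : Continuous fun x => ∫ t in (0:ℝ)..x, Real.exp (-(∫ s in (0:ℝ)..t, r s)) ^ 2 :=
    continuous_primitive (fun a b => hec.intervalIntegrable a b) 0
  have hYc : Continuous fun b => Real.exp (∫ s in (0:ℝ)..b, r s) *
      (y 0 + u 0 * ∫ t in (0:ℝ)..b, Real.exp (-(∫ s in (0:ℝ)..t, r s)) ^ 2) := by fun_prop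
  refine hy.intervalIntegrable_of_nonneg (hr.of_eq_add_continuous hRc hQ) hYc
    (U := fun b => u 0 * Real.exp (-∫ s in (0:ℝ)..b, r s) - (∫ s in (0:ℝ)..b, r s ^ 2) *
      (Real.exp (∫ s in (0:ℝ)..b, r s) *
        (y 0 + u 0 * ∫ t in (0:ℝ)..b, Real.exp (-(∫ s in (0:ℝ)..t, r s)) ^ 2)))
    (by fun_prop) (fun t hf hg => ?_) hx
  obtain ⟨h1, h2⟩ := hy.eq_explicit hr hQ hf hg
  exact ⟨h2, by rw [← h2]; linarith⟩

/-- On all of `ℝ`, solutions of `L_q y = 0` with `q = r' + r²` are given explicitly by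
variation of constants. -/
theorem SolvesWith.eq_explicit_everywhere {r Q y u : ℝ → ℝ} (hr : LocL2 r)
    (hQ : ∀ x : ℝ, Q x = r x + ∫ s in (0:ℝ)..x, r s ^ 2) (hy : SolvesWith Q y u) (x : ℝ) :
    (∫ s in (0:ℝ)..x, r s ^ 2) * y x + u x = u 0 * Real.exp (-∫ s in (0:ℝ)..x, r s) ∧
    y x = Real.exp (∫ s in (0:ℝ)..x, r s) *
      (y 0 + u 0 * ∫ t in (0:ℝ)..x, Real.exp (-(∫ s in (0:ℝ)..t, r s)) ^ 2) := by
  rcases le_total 0 x with hx | hx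
  · obtain ⟨hf, hg⟩ := hy.intervalIntegrable_of_riccati hr hQ hx
    exact hy.eq_explicit hr hQ hf hg
  · obtain ⟨hf, hg⟩ := hy.reflect.intervalIntegrable_of_riccati hr.neg_comp_neg (reflect_riccati hQ)
      (neg_nonneg.2 hx)
    refine hy.eq_explicit hr hQ ?_ ?_
    · have h := ((IntervalIntegrable.iff_comp_neg (by finiteness)).1 hf).neg
      rw [neg_neg, neg_zero] at h
      convert! h using 1
      ext t
      simp only [Pi.neg_apply, neg_neg]
      ring
    · simpa using! (IntervalIntegrable.iff_comp_neg (by finiteness)).1 hg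

/-- A solution with a zero for which `y` and `P y = y' - r y` are square integrable near `+∞`
vanishes identically: `y · P y` is nondecreasing, with derivative `(P y)²`, and integrable. -/
theorem SolvesWith.eq_zero_of_integrableOn_Ioi {r Q y u : ℝ → ℝ} (hr : LocL2 r)
    (hQ : ∀ x : ℝ, Q x = r x + ∫ s in (0:ℝ)..x, r s ^ 2) (hy : SolvesWith Q y u)
    (hyL : IntegrableOn (fun x => y x ^ 2) (Ioi 0))
    (hvL : IntegrableOn (fun x => (Q x * y x + u x - r x * y x) ^ 2) (Ioi 0))
    {a : ℝ} (ha : y a = 0) (x : ℝ) : y x = 0 := by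
  have hex := hy.eq_explicit_everywhere hr hQ
  have hpc : Continuous fun x => ∫ s in (0:ℝ)..x, r s :=
    continuous_primitive hr.intervalIntegrable 0
  set p : ℝ → ℝ := fun x => ∫ s in (0:ℝ)..x, r s with hp
  have hec : Continuous fun t => Real.exp (-p t) ^ 2 := by fun_prop
  have hi : ∀ a b, IntervalIntegrable (fun t => Real.exp (-p t) ^ 2) volume a b :=
    fun a b => hec.intervalIntegrable a b
  have hya : y 0 + u 0 * ∫ t in (0:ℝ)..a, Real.exp (-p t) ^ 2 = 0 := by
    have h := (hex a).2
    rw [ha] at h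
    exact (mul_eq_zero.1 h.symm).resolve_left (Real.exp_pos _).ne'
  have hyx : ∀ x, y x = Real.exp (p x) * (u 0 * ∫ t in a..x, Real.exp (-p t) ^ 2) := by
    intro x
    have h : y x = Real.exp (p x) * (y 0 + u 0 * ∫ t in (0:ℝ)..x, Real.exp (-p t) ^ 2) := (hex x).2
    rw [h, ← integral_add_adjacent_intervals (hi 0 a) (hi a x)]
    linear_combination Real.exp (p x) * hya
  suffices hu : u 0 = 0 by rw [hyx x, hu]; simp
  by_contra hu
  have hprod : ∀ x, (Q x * y x + u x - r x * y x) * y x =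
      u 0 ^ 2 * ∫ t in a..x, Real.exp (-p t) ^ 2 := by
    intro x
    have h1 : Q x * y x + u x - r x * y x = u 0 * Real.exp (-p x) := by
      rw [← (hex x).1, hQ x]
      ring
    have h2 : Real.exp (-p x) * Real.exp (p x) = 1 := by rw [← Real.exp_add]; simp
    rw [h1, hyx x]
    linear_combination (u 0 ^ 2 * ∫ t in a..x, Real.exp (-p t) ^ 2) * h2
  set c : ℝ := u 0 ^ 2 * ∫ t in a..(a + 1), Real.exp (-p t) ^ 2 with hc
  have hc0 : 0 < c := mul_pos (by positivity)
    (intervalIntegral_pos_of_pos_on (hi _ _) (fun t _ => by positivity) (by linarith))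
  have hlow : ∀ x, a + 1 ≤ x → c ≤ (Q x * y x + u x - r x * y x) * y x := by
    intro x hx
    rw [hprod x, hc, ← integral_add_adjacent_intervals (hi a (a + 1)) (hi (a + 1) x)]
    have := integral_nonneg (μ := volume) hx fun t _ => sq_nonneg (Real.exp (-p t))
    gcongr
    linarith
  set N := max 0 (a + 1) with hN
  have hint : IntegrableOn (fun _ : ℝ => c) (Ioi N) := by
    refine ((hyL.add hvL).mono_set (Ioi_subset_Ioi (le_max_left _ _))).mono'
      aestronglyMeasurable_const ?_
    filter_upwards [ae_restrict_mem measurableSet_Ioi] with t ht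
    have := hlow t ((le_max_right _ _).trans (le_of_lt ht))
    rw [Real.norm_of_nonneg hc0.le]
    simp only [Pi.add_apply]
    nlinarith [sq_nonneg (y t - (Q t * y t + u t - r t * y t)), sq_nonneg (y t),
      sq_nonneg (Q t * y t + u t - r t * y t)]
  rw [integrableOn_const_iff] at hint
  simp [hc0.ne'] at hint

/-- **Lemma (zeros of half-line `L²` solutions when `λ₀(q) > 0`).** Let `r ∈ L²_loc(ℝ)`,
`q = B(r) = r' + r²` with antiderivative `Q x = r x + ∫₀ˣ r²`, and suppose `λ₀(q) > 0` in the
factorized form: there is `ε > 0` with `∫ (φ' - r φ)² ≥ ε ∫ φ²` for all test functions `φ`.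
If `y` solves `L_q y = 0` (system sense, with `y' = Q y + u` a.e., so `Py = y' - r y
= Q y + u - r y`) and either `y, Py ∈ L²(0,∞)` or `y, Py ∈ L²(-∞,0)`, then either `y` has no
zeros on `ℝ` or `y ≡ 0`. -/
theorem halfline_L2_solution_no_zeros (r : ℝ → ℝ) (hr : LocL2 r)
    (Q : ℝ → ℝ) (hQdef : ∀ x : ℝ, Q x = r x + ∫ s in (0:ℝ)..x, r s ^ 2)
    (hpos : ∃ ε > (0:ℝ), ∀ φ : ℝ → ℝ, ContDiff ℝ (⊤ : ℕ∞) φ → HasCompactSupport φ →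
      ε * (∫ x : ℝ, φ x ^ 2) ≤ ∫ x : ℝ, (deriv φ x - r x * φ x) ^ 2)
    (y u : ℝ → ℝ) (hy : SolvesWith Q y u)
    (hL2 : (IntegrableOn (fun x => y x ^ 2) (Set.Ioi 0) volume ∧
            IntegrableOn (fun x => (Q x * y x + u x - r x * y x) ^ 2) (Set.Ioi 0) volume) ∨
           (IntegrableOn (fun x => y x ^ 2) (Set.Iio 0) volume ∧
            IntegrableOn (fun x => (Q x * y x + u x - r x * y x) ^ 2) (Set.Iio 0) volume)) :
    (∀ x : ℝ, y x ≠ 0) ∨ (∀ x : ℝ, y x = 0) := by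
  by_cases h : ∀ x, y x ≠ 0
  · exact Or.inl h
  push Not at h
  obtain ⟨a, ha⟩ := h
  refine Or.inr ?_
  rcases hL2 with ⟨h1, h2⟩ | ⟨h1, h2⟩
  · exact hy.eq_zero_of_integrableOn_Ioi hr hQdef h1 h2 ha
  · have hR : ∀ {h : ℝ → ℝ}, IntegrableOn h (Iio 0) → IntegrableOn (fun x => h (-x)) (Ioi 0) :=
      fun h => IntegrableOn.comp_neg_Ioi (by rwa [neg_zero])
    intro x
    have h := hy.reflect.eq_zero_of_integrableOn_Ioi hr.neg_comp_neg (reflect_riccati hQdef)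
      (hR h1) ?_ (a := -a) (by rwa [neg_neg]) (-x)
    · rwa [neg_neg] at h
    · refine (hR h2).congr_fun (fun x _ => ?_) measurableSet_Ioi
      ring
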